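/- arXiv:1210.6343 — 2 statements merged into one kernel-verified Lean document; each statement's English description precedes it below -/
import Mathlib

section
/- (Lemma 7) Let n ≥ 2 and x = (x₁, …, xₙ)ᵀ ∈ ℤⁿ with 1 ≤ x_i ≤ n for i = 1, …, n, and suppose A(n)x <> 0. Then x = ½ (A(n)ᵀ sgn(A(n)x) + (n+1)·1ₙ); equivalently 2x = A(n)ᵀ sgn(A(n)x) + (n+1)·1ₙ, where 1ₙ is the all-ones vector in ℤⁿ. -/
open Matrix

/-- The difference matrix `A(n)`: rows are indexed by pairs `(i, j)` with `i < j`,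
row `(i, j)` has entry `+1` in column `i`, entry `-1` in column `j`, and `0` elsewhere. -/
def Amat (n : ℕ) : Matrix {p : Fin n × Fin n // p.1 < p.2} (Fin n) ℤ :=
  fun p k => if k = p.val.1 then 1 else if k = p.val.2 then -1 else 0

theorem Amat_mulVec_apply {n : ℕ} (x : Fin n → ℤ) (p : {p : Fin n × Fin n // p.1 < p.2}) :
    (Amat n *ᵥ x) p = x p.val.1 - x p.val.2 := by
  have h (k : Fin n) : Amat n p k * x k =
      (if k = p.val.1 then x k else 0) - (if k = p.val.2 then x k else 0) := by
    have := p.prop.ne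
    unfold Amat
    grind
  simp [Matrix.mulVec, dotProduct, h, Finset.sum_sub_distrib]

theorem Amat_transpose_mulVec_sign_apply {n : ℕ} (x : Fin n → ℤ) (k : Fin n) :
    ((Amat n)ᵀ *ᵥ fun p => Int.sign ((Amat n *ᵥ x) p)) k = ∑ j, Int.sign (x k - x j) := by
  have hpair (i j : Fin n) :
      (if i < j then (if k = i then 1 else if k = j then -1 else 0) * Int.sign (x i - x j)
        else 0) =
      (if k = i then (if k < j then Int.sign (x k - x j) else 0) else 0) +
        (if k = j then (if i < k then Int.sign (x k - x i) else 0) else 0) := by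
    have := Int.sign_neg (x i - x j)
    rw [neg_sub] at this
    grind
  simp only [Amat_mulVec_apply]
  change ∑ p, Amat n p k * Int.sign (x p.val.1 - x p.val.2) = _
  calc ∑ p : {p : Fin n × Fin n // p.1 < p.2}, Amat n p k * Int.sign (x p.val.1 - x p.val.2)
      = ∑ p : Fin n × Fin n, if p.1 < p.2 then
          (if k = p.1 then 1 else if k = p.2 then -1 else 0) * Int.sign (x p.1 - x p.2)
          else 0 := by
        rw [← Finset.sum_filter]
        exact (Finset.sum_subtype (Finset.univ.filter fun p : Fin n × Fin n => p.1 < p.2)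
          (by simp) fun p => (if k = p.1 then 1 else if k = p.2 then -1 else 0) *
            Int.sign (x p.1 - x p.2)).symm
    _ = (∑ j, if k < j then Int.sign (x k - x j) else 0) +
          ∑ i, if i < k then Int.sign (x k - x i) else 0 := by
        simp only [Fintype.sum_prod_type, hpair, Finset.sum_add_distrib]
        congr 1
        · rw [Finset.sum_comm]
          simp
        · simp
    _ = ∑ j, Int.sign (x k - x j) := by
        rw [← Finset.sum_add_distrib]
        refine Finset.sum_congr rfl fun j _ => ?_
        rcases lt_trichotomy k j with h | rfl | h
        · simp [h, h.not_gt]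
        · simp
        · simp [h, h.not_gt]

theorem sum_range_sign_sub {a : ℤ} (ha : 1 ≤ a) (n : ℕ) :
    ∑ v ∈ Finset.range n, Int.sign (a - (v + 1)) =
      if (n : ℤ) < a then (n : ℤ) else 2 * a - 1 - n := by
  induction n with
  | zero => simp; omega
  | succ n ih =>
    rw [Finset.sum_range_succ, ih]
    push_cast
    rcases lt_trichotomy a (n + 1) with h | h | h
    · rw [Int.sign_eq_neg_one_of_neg (by omega)]
      split_ifs <;> omega
    · rw [h, sub_self, Int.sign_zero]
      split_ifs <;> omega
    · rw [Int.sign_eq_one_of_pos (by omega)]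
      split_ifs <;> omega

theorem sum_comp_eq_sum_range_of_injective {M : Type*} [AddCommMonoid M] {n : ℕ} {x : Fin n → ℤ}
    (hb : ∀ i, 1 ≤ x i ∧ x i ≤ (n : ℤ)) (hx : Function.Injective x) (f : ℤ → M) :
    ∑ j, f (x j) = ∑ v ∈ Finset.range n, f (v + 1) := by
  let g (i : Fin n) : Fin n := ⟨(x i - 1).toNat, by have := hb i; omega⟩
  have hg (i : Fin n) : ((g i : ℕ) : ℤ) + 1 = x i := by
    have := hb i
    simp only [g]
    omega
  have hinj : Function.Injective g := fun i j h => hx (by rw [← hg i, ← hg j, h])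
  rw [← Fin.sum_univ_eq_sum_range (fun v : ℕ => f (v + 1)),
    ← (Finite.injective_iff_bijective.mp hinj).sum_comp fun v : Fin n => f ((v : ℕ) + 1)]
  simp only [hg]

theorem injective_of_Amat_mulVec_ne_zero {n : ℕ} {x : Fin n → ℤ}
    (hx : ∀ p, (Amat n *ᵥ x) p ≠ 0) : Function.Injective x := by
  intro i j hij
  rcases lt_trichotomy i j with h | h | h
  · exact absurd (by simp [Amat_mulVec_apply, hij]) (hx ⟨(i, j), h⟩)
  · exact h
  · exact absurd (by simp [Amat_mulVec_apply, hij]) (hx ⟨(j, i), h⟩)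

/-- Lemma 7: if `1 ≤ xᵢ ≤ n` for all `i` and `A(n)x <> 0`, then
`2x = A(n)ᵀ sgn(A(n)x) + (n+1)·1ₙ`. -/
theorem two_smul_eq_transpose_mulVec_sign (n : ℕ) (hn : 2 ≤ n) (x : Fin n → ℤ)
    (hb : ∀ i, 1 ≤ x i ∧ x i ≤ (n : ℤ))
    (hx : ∀ p, (Amat n *ᵥ x) p ≠ 0) :
    (2 : ℤ) • x =
      ((Amat n)ᵀ *ᵥ fun p => Int.sign ((Amat n *ᵥ x) p)) + ((n : ℤ) + 1) • (1 : Fin n → ℤ) := by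
  ext k
  rw [Pi.add_apply, Amat_transpose_mulVec_sign_apply,
    sum_comp_eq_sum_range_of_injective hb (injective_of_Amat_mulVec_ne_zero hx)
      fun v => Int.sign (x k - v),
    sum_range_sign_sub (hb k).1, if_neg (hb k).2.not_gt]
  simp only [Pi.smul_apply, Pi.one_apply, smul_eq_mul]
  ring
end

section
/- (Theorem 2) Let n ≥ 2 and let x ∈ ℤ^{n²} be a solution of the generalized Sudoku problem with permutations π₁, π₂, π₃. Then x = ½ (A_{π_r}ᵀ sgn(A_{π_r} x) + (n+1)·1_{n²}) for each r = 1, 2, 3; equivalently 2x = A_{π_r}ᵀ sgn(A_{π_r} x) + (n+1)·1_{n²} for each r = 1, 2, 3. -/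
open Matrix

/-- The `(n·s(n)) × n²` block-diagonal matrix `A` with `n` copies of `A(n)` along the
diagonal and zeros elsewhere.  Columns are indexed by `Fin (n * n)` in the row-major
layout `(r, j) ↦ r·n + j` given by `finProdFinEquiv`. -/
def bigA (n : ℕ) : Matrix (Fin n × {p : Fin n × Fin n // p.1 < p.2}) (Fin (n * n)) ℤ :=
  fun r c =>
    if (finProdFinEquiv.symm c).1 = r.1 then Amat n r.2 (finProdFinEquiv.symm c).2 else 0

/-- `A_π`: the matrix `A` with columns permuted by `π`, i.e. the `j`-th column of `A_π`
is the `π⁻¹(j)`-th column of `A`. -/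
def Aperm (n : ℕ) (π : Equiv.Perm (Fin (n * n))) :
    Matrix (Fin n × {p : Fin n × Fin n // p.1 < p.2}) (Fin (n * n)) ℤ :=
  (bigA n).submatrix id ⇑π.symm

/-- The row of `A(n)` indexed by `(i, j)` computes the difference of entries `i` and `j`. -/
lemma Amat_mulVec (n : ℕ) (y : Fin n → ℤ) (p : {p : Fin n × Fin n // p.1 < p.2}) :
    (Amat n *ᵥ y) p = y p.val.1 - y p.val.2 := by
  have h : ∀ k, Amat n p k * y k =
      (if k = p.val.1 then y k else 0) - (if k = p.val.2 then y k else 0) := by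
    intro k
    have := p.2.ne
    unfold Amat
    split_ifs <;> simp_all
  simp [mulVec, dotProduct, h]

lemma Amat_transpose_mulVec_sign (n : ℕ) (y : Fin n → ℤ) (k : Fin n) :
    ∑ p, Amat n p k * Int.sign (y p.val.1 - y p.val.2) = ∑ j, Int.sign (y k - y j) := by
  have h : ∀ i j : Fin n, (if i < j then
      (if k = i then 1 else if k = j then -1 else 0) * Int.sign (y i - y j) else 0) =
      (if k = i then if k < j then Int.sign (y k - y j) else 0 else 0) +
      (if k = j then if i < k then Int.sign (y k - y i) else 0 else 0) := by
    intro i j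
    have hs : Int.sign (y j - y i) = -Int.sign (y i - y j) := by
      rw [← Int.sign_neg, neg_sub]
    by_cases hi : k = i
    · subst hi
      by_cases hj : k = j <;> simp [hj]
    · by_cases hj : k = j
      · subst hj
        simp [hi, hs]
      · simp [hi, hj]
  have hsub := Finset.sum_subtype (Finset.univ.filter fun p : Fin n × Fin n => p.1 < p.2)
    (p := fun p => p.1 < p.2) (F := inferInstance) (by simp)
    (fun p => (if k = p.1 then 1 else if k = p.2 then -1 else 0) * Int.sign (y p.1 - y p.2))
  unfold Amat
  rw [← hsub, Finset.sum_filter, Fintype.sum_prod_type]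
  simp only [h, Finset.sum_add_distrib]
  rw [Finset.sum_comm]
  simp only [Finset.sum_ite_eq, Finset.mem_univ, if_true]
  rw [← Finset.sum_add_distrib]
  refine Finset.sum_congr rfl fun j _ => ?_
  rcases lt_trichotomy k j with hkj | rfl | hkj
  · simp [hkj, hkj.not_gt]
  · simp
  · simp [hkj, hkj.not_gt]

lemma sum_Icc_sign_sub (n : ℕ) (m : ℤ) (h1 : 1 ≤ m) (hm : m ≤ n) :
    ∑ v ∈ Finset.Icc 1 (n : ℤ), Int.sign (m - v) = 2 * m - (n + 1) := by
  have h : ∀ v : ℤ, Int.sign (m - v) = (if v < m then 1 else 0) - (if m < v then 1 else 0) := by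
    intro v
    rcases lt_trichotomy v m with hv | rfl | hv
    · simp [Int.sign_eq_one_of_pos (sub_pos.2 hv), hv, hv.not_gt]
    · simp
    · simp [Int.sign_eq_neg_one_of_neg (sub_neg.2 hv), hv, hv.not_gt]
  have hlo : (Finset.Icc 1 (n : ℤ)).filter (· < m) = Finset.Ico 1 m := by
    ext v; simp only [Finset.mem_filter, Finset.mem_Icc, Finset.mem_Ico]; omega
  have hhi : (Finset.Icc 1 (n : ℤ)).filter (m < ·) = Finset.Ioc m n := by
    ext v; simp only [Finset.mem_filter, Finset.mem_Icc, Finset.mem_Ioc]; omega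
  simp only [h, Finset.sum_sub_distrib, Finset.sum_boole, hlo, hhi, Int.card_Ico, Int.card_Ioc]
  omega

/-- An injective `y` with values in `{1, …, n}` is a bijection onto it, so the signs of the
differences determine each value. -/
lemma sum_sign_sub_of_injective (n : ℕ) (y : Fin n → ℤ) (hy : Function.Injective y)
    (hb : ∀ i, 1 ≤ y i ∧ y i ≤ (n : ℤ)) (k : Fin n) :
    ∑ j, Int.sign (y k - y j) = 2 * y k - (n + 1) := by
  have himg : Finset.univ.image y = Finset.Icc 1 (n : ℤ) := by
    refine Finset.eq_of_subset_of_card_le (fun v hv => ?_) ?_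
    · obtain ⟨i, -, rfl⟩ := Finset.mem_image.1 hv
      exact Finset.mem_Icc.2 (hb i)
    · simp [Finset.card_image_of_injective _ hy]
  rw [← sum_Icc_sign_sub n (y k) (hb k).1 (hb k).2, ← himg, Finset.sum_image hy.injOn]

lemma Aperm_mulVec (n : ℕ) (π : Equiv.Perm (Fin (n * n))) (x : Fin (n * n) → ℤ) (b : Fin n)
    (p : {p : Fin n × Fin n // p.1 < p.2}) :
    (Aperm n π *ᵥ x) (b, p) =
      x (π (finProdFinEquiv (b, p.val.1))) - x (π (finProdFinEquiv (b, p.val.2))) := by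
  rw [← Amat_mulVec n fun j => x (π (finProdFinEquiv (b, j)))]
  simp only [mulVec, dotProduct, Aperm, bigA, submatrix_apply, id]
  rw [← (finProdFinEquiv.trans π).sum_comp, Fintype.sum_prod_type]
  simp [ite_mul, Finset.sum_ite_irrel]

/-- Theorem 2: every solution `x` of the generalized Sudoku problem (with permutations
`π 0, π 1, π 2`, `k ≤ n²` given indices `idx l` with prescribed values `g l`) satisfies
`2x = A_{π_r}ᵀ sgn(A_{π_r} x) + (n+1)·1_{n²}` for each `r = 1, 2, 3`. -/
theorem generalized_sudoku_necessary (n : ℕ) (hn : 2 ≤ n)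
    (π : Fin 3 → Equiv.Perm (Fin (n * n)))
    (k : ℕ) (hk : k ≤ n * n) (idx : Fin k → Fin (n * n)) (g : Fin k → ℤ)
    (hg : ∀ l, 1 ≤ g l ∧ g l ≤ (n : ℤ))
    (x : Fin (n * n) → ℤ)
    (hxb : ∀ i, 1 ≤ x i ∧ x i ≤ (n : ℤ))
    (hxA : ∀ r p, (Aperm n (π r) *ᵥ x) p ≠ 0)
    (hxg : ∀ l, x (idx l) = g l) :
    ∀ r : Fin 3,
      (2 : ℤ) • x =
        ((Aperm n (π r))ᵀ *ᵥ fun p => Int.sign ((Aperm n (π r) *ᵥ x) p)) +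
          ((n : ℤ) + 1) • (1 : Fin (n * n) → ℤ) := by
  intro r
  ext c
  obtain ⟨⟨b, j⟩, rfl⟩ := (finProdFinEquiv.trans (π r)).surjective c
  have hinj : Function.Injective fun j => x (π r (finProdFinEquiv (b, j))) := by
    intro i j hij
    by_contra hne
    rcases lt_or_gt_of_ne hne with h | h
    · refine hxA r (b, ⟨(i, j), h⟩) ?_
      rw [Aperm_mulVec]
      exact sub_eq_zero.2 hij
    · refine hxA r (b, ⟨(j, i), h⟩) ?_
      rw [Aperm_mulVec]
      exact sub_eq_zero.2 hij.symm
  have hsum : ((Aperm n (π r))ᵀ *ᵥ fun p => Int.sign ((Aperm n (π r) *ᵥ x) p))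
      (π r (finProdFinEquiv (b, j))) = 2 * x (π r (finProdFinEquiv (b, j))) - (n + 1) := by
    rw [← sum_sign_sub_of_injective n _ hinj (fun i => hxb _) j,
      ← Amat_transpose_mulVec_sign n fun j => x (π r (finProdFinEquiv (b, j)))]
    simp only [mulVec, dotProduct, transpose_apply]
    rw [Fintype.sum_prod_type, Finset.sum_eq_single b]
    · refine Finset.sum_congr rfl fun p _ => ?_
      rw [← Aperm_mulVec]
      simp [Aperm, bigA, mulVec, dotProduct]
    · intro a _ ha
      simp [Aperm, bigA, ha.symm]
    · simp
  simp only [Pi.add_apply, Pi.smul_apply, Equiv.trans_apply, hsum, Pi.one_apply, smul_eq_mul]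
  ring
end
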